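/- arXiv:math/0012218 — 5 statements merged into one kernel-verified Lean document; each statement's English description precedes it below -/
import Mathlib

section
/- Let α be a smooth compactly supported complex-valued 1-form on ℝ⁴ such that the self-dual part of dα vanishes, i.e. ★(dα) = −i·dα (dα is anti-self-dual with respect to the Minkowski Hodge star). Then there exists a smooth compactly supported function f : ℝ⁴ → ℂ with α = df. (This is the vanishing of the compactly supported cohomology group H⁰_{Q,c}(Z, O(0)) = Ker(d : Λ¹_c → Λ²_{−,c}) / Im(d : Λ⁰_c → Λ¹_c) deduced from the compactly supported Penrose transform.) -/
open scoped BigOperators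

/-- The partial derivative in the `μ`-th coordinate direction. -/
noncomputable def pd4 (μ : Fin 4) (f : (Fin 4 → ℝ) → ℂ) (x : Fin 4 → ℝ) : ℂ :=
  fderiv ℝ f x (Pi.single μ 1)

/-- The Levi-Civita symbol on four indices: the sign of the permutation `(a,b,c,d)`
of `(0,1,2,3)`, and `0` if two indices coincide. -/
def levi (a b c d : Fin 4) : ℤ :=
  ((b : ℤ) - a).sign * ((c : ℤ) - a).sign * ((d : ℤ) - a).sign *
    ((c : ℤ) - b).sign * ((d : ℤ) - b).sign * ((d : ℤ) - c).sign

/-- The (inverse) Minkowski metric `η = diag(1,−1,−1,−1)` (diagonal entries). -/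
noncomputable def mink (μ : Fin 4) : ℂ := if μ = 0 then 1 else -1

/-- The ℂ-linear Hodge star operator of the Minkowski metric on complex 2-forms on ℝ⁴,
acting on the antisymmetric matrix of components `F μ ν`:
`(★F)_{μν} = ½ ε_{μνρσ} η^{ρρ'} η^{σσ'} F_{ρ'σ'}`.
It satisfies `★(dx⁰∧dx¹) = −dx²∧dx³`, `★(dx⁰∧dx²) = dx¹∧dx³`, `★(dx⁰∧dx³) = −dx¹∧dx²`,
`★(dx²∧dx³) = dx⁰∧dx¹`, `★(dx¹∧dx³) = −dx⁰∧dx²`, `★(dx¹∧dx²) = dx⁰∧dx³`. -/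
noncomputable def hodge2 (F : Fin 4 → Fin 4 → ℂ) (μ ν : Fin 4) : ℂ :=
  (1 / 2 : ℂ) * ∑ ρ : Fin 4, ∑ σ : Fin 4, (levi μ ν ρ σ : ℂ) * mink ρ * mink σ * F ρ σ

/-- The components `(dα)_{μν} = ∂_μ α_ν − ∂_ν α_μ` of the exterior derivative of the
complex 1-form on ℝ⁴ with components `α x μ`. -/
noncomputable def extDerivOne (α : (Fin 4 → ℝ) → Fin 4 → ℂ) (x : Fin 4 → ℝ) (μ ν : Fin 4) : ℂ :=
  pd4 μ (fun y => α y ν) x - pd4 ν (fun y => α y μ) x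


open MeasureTheory in
theorem aux_int (μ : Fin 4) (g : (Fin 4 → ℝ) → ℂ) (hg : ContDiff ℝ 1 g)
    (hc : HasCompactSupport g) :
    Integrable (pd4 μ g) ∧ ∫ x, pd4 μ g x = 0 := by
  have hcont : Continuous (pd4 μ g) := by
    unfold pd4
    exact (hg.continuous_fderiv one_ne_zero).clm_apply continuous_const
  have hcs : HasCompactSupport (pd4 μ g) := hc.fderiv_apply (𝕜 := ℝ) _
  have hi : Integrable (pd4 μ g) := hcont.integrable_of_hasCompactSupport hcs
  refine ⟨hi, ?_⟩
  have := integral_mul_fderiv_eq_neg_fderiv_mul_of_integrable (μ := (volume : Measure (Fin 4 → ℝ)))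
    (f := fun _ => (1 : ℂ)) (g := g) (v := Pi.single μ 1) (by simp)
    (by simp only [one_mul]; exact hi) (by simpa using hg.continuous.integrable_of_hasCompactSupport hc)
    (by intro x _; fun_prop) (by intro x _; exact hg.differentiable one_ne_zero x)
  simpa [pd4] using this

theorem aux_mul (μ : Fin 4) (f g : (Fin 4 → ℝ) → ℂ) (hf : Differentiable ℝ f)
    (hg : Differentiable ℝ g) (x) :
    pd4 μ (fun y => f y * g y) x = pd4 μ f x * g x + f x * pd4 μ g x := by
  unfold pd4
  rw [fderiv_fun_mul (hf x) (hg x)]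
  simp
  ring

theorem aux_sub (μ : Fin 4) (f g : (Fin 4 → ℝ) → ℂ) (hf : Differentiable ℝ f)
    (hg : Differentiable ℝ g) (x) :
    pd4 μ (fun y => f y - g y) x = pd4 μ f x - pd4 μ g x := by
  unfold pd4
  rw [fderiv_fun_sub (hf x) (hg x)]
  simp

theorem aux_add (μ : Fin 4) (f g : (Fin 4 → ℝ) → ℂ) (hf : Differentiable ℝ f)
    (hg : Differentiable ℝ g) (x) :
    pd4 μ (fun y => f y + g y) x = pd4 μ f x + pd4 μ g x := by
  unfold pd4
  rw [fderiv_fun_add (hf x) (hg x)]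
  simp

theorem aux_conj (μ : Fin 4) (f : (Fin 4 → ℝ) → ℂ) (x) :
    pd4 μ (fun y => star (f y)) x = star (pd4 μ f x) := by
  unfold pd4
  have := Complex.conjCLE.comp_fderiv (f := f) (x := x)
  have h2 : (fun y => star (f y)) = Complex.conjCLE ∘ f := by ext y; simp
  rw [h2, this]
  simp

theorem aux_X (μ : Fin 4) (x) :
    pd4 μ (fun y => ((y 0 : ℝ) : ℂ)) x = if μ = 0 then 1 else 0 := by
  unfold pd4
  have : HasFDerivAt (fun y : Fin 4 → ℝ => ((y 0 : ℝ) : ℂ))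
      (Complex.ofRealCLM.comp (ContinuousLinearMap.proj (R := ℝ) (φ := fun _ : Fin 4 => ℝ) 0)) x :=
    (Complex.ofRealCLM.comp
      (ContinuousLinearMap.proj (R := ℝ) (φ := fun _ : Fin 4 => ℝ) 0)).hasFDerivAt
  rw [this.fderiv]
  by_cases h : μ = 0
  · subst h; simp
  · simp [h, Ne.symm h]

theorem aux_smooth (μ : Fin 4) (f : (Fin 4 → ℝ) → ℂ) (hf : ContDiff ℝ (⊤ : ℕ∞) f) :
    ContDiff ℝ (⊤ : ℕ∞) (pd4 μ f) := by
  unfold pd4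
  exact (hf.fderiv_right (by simp)).clm_apply contDiff_const

theorem aux_comm (μ ν : Fin 4) (f : (Fin 4 → ℝ) → ℂ) (hf : ContDiff ℝ (⊤ : ℕ∞) f) (x) :
    pd4 μ (pd4 ν f) x = pd4 ν (pd4 μ f) x := by
  have hs : IsSymmSndFDerivAt ℝ f x :=
    hf.contDiffAt.isSymmSndFDerivAt (by simpa using (WithTop.coe_le_coe.2 le_top : ((2 : ℕ∞) : WithTop ℕ∞) ≤ ((⊤ : ℕ∞) : WithTop ℕ∞)))
  have hd : DifferentiableAt ℝ (fderiv ℝ f) x :=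
    (hf.fderiv_right (m := 1)
      (WithTop.coe_le_coe.2 le_top : ((2 : ℕ∞) : WithTop ℕ∞) ≤ ((⊤ : ℕ∞) : WithTop ℕ∞))).differentiable one_ne_zero x
  have key : ∀ a b : Fin 4, pd4 a (pd4 b f) x
      = fderiv ℝ (fderiv ℝ f) x (Pi.single a 1) (Pi.single b 1) := by
    intro a b
    unfold pd4
    rw [fderiv_clm_apply hd (differentiableAt_const _)]
    simp
  rw [key, key]
  exact hs _ _

open MeasureTheory in
/-- Energy argument: a compactly supported solution of `∂₀E = i curl E` vanishes. -/
theorem aux_energy (E₁ E₂ E₃ : (Fin 4 → ℝ) → ℂ)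
    (h₁ : ContDiff ℝ 1 E₁) (h₂ : ContDiff ℝ 1 E₂) (h₃ : ContDiff ℝ 1 E₃)
    (c₁ : HasCompactSupport E₁) (c₂ : HasCompactSupport E₂) (c₃ : HasCompactSupport E₃)
    (m₁ : ∀ x, pd4 0 E₁ x = Complex.I * (pd4 2 E₃ x - pd4 3 E₂ x))
    (m₂ : ∀ x, pd4 0 E₂ x = Complex.I * (pd4 3 E₁ x - pd4 1 E₃ x))
    (m₃ : ∀ x, pd4 0 E₃ x = Complex.I * (pd4 1 E₂ x - pd4 2 E₁ x)) (x : Fin 4 → ℝ) :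
    E₁ x = 0 ∧ E₂ x = 0 ∧ E₃ x = 0 := by
  have hX : ContDiff ℝ 1 (fun y : Fin 4 → ℝ => ((y 0 : ℝ) : ℂ)) := by
    exact Complex.ofRealCLM.contDiff.comp (contDiff_apply ℝ ℝ (0 : Fin 4))
  have s₁ : ContDiff ℝ 1 (fun y => star (E₁ y)) := Complex.conjCLE.contDiff.comp h₁
  have s₂ : ContDiff ℝ 1 (fun y => star (E₂ y)) := Complex.conjCLE.contDiff.comp h₂
  have s₃ : ContDiff ℝ 1 (fun y => star (E₃ y)) := Complex.conjCLE.contDiff.comp h₃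
  have dX := hX.differentiable one_ne_zero
  have d₁ := h₁.differentiable one_ne_zero
  have d₂ := h₂.differentiable one_ne_zero
  have d₃ := h₃.differentiable one_ne_zero
  have e₁ := s₁.differentiable one_ne_zero
  have e₂ := s₂.differentiable one_ne_zero
  have e₃ := s₃.differentiable one_ne_zero
  -- components of the weighted current
  have J0 := aux_int 0 (fun y => ((y 0 : ℝ) : ℂ) *
      (E₁ y * star (E₁ y) + E₂ y * star (E₂ y) + E₃ y * star (E₃ y)))
    (hX.mul (((h₁.mul s₁).add (h₂.mul s₂)).add (h₃.mul s₃)))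
    (((c₁.mul_right.add c₂.mul_right).add c₃.mul_right).mul_left)
  have J1 := aux_int 1 (fun y => ((y 0 : ℝ) : ℂ) * (E₂ y * star (E₃ y) - E₃ y * star (E₂ y)))
    (hX.mul ((h₂.mul s₃).sub (h₃.mul s₂))) ((c₂.mul_right.sub c₃.mul_right).mul_left)
  have J2 := aux_int 2 (fun y => ((y 0 : ℝ) : ℂ) * (E₃ y * star (E₁ y) - E₁ y * star (E₃ y)))
    (hX.mul ((h₃.mul s₁).sub (h₁.mul s₃))) ((c₃.mul_right.sub c₁.mul_right).mul_left)
  have J3 := aux_int 3 (fun y => ((y 0 : ℝ) : ℂ) * (E₁ y * star (E₂ y) - E₂ y * star (E₁ y)))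
    (hX.mul ((h₁.mul s₂).sub (h₂.mul s₁))) ((c₁.mul_right.sub c₂.mul_right).mul_left)
  have key : ∀ y, E₁ y * star (E₁ y) + E₂ y * star (E₂ y) + E₃ y * star (E₃ y) =
      pd4 0 (fun y => ((y 0 : ℝ) : ℂ) *
        (E₁ y * star (E₁ y) + E₂ y * star (E₂ y) + E₃ y * star (E₃ y))) y
      - Complex.I *
       (pd4 1 (fun y => ((y 0 : ℝ) : ℂ) * (E₂ y * star (E₃ y) - E₃ y * star (E₂ y))) y
      + pd4 2 (fun y => ((y 0 : ℝ) : ℂ) * (E₃ y * star (E₁ y) - E₁ y * star (E₃ y))) y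
      + pd4 3 (fun y => ((y 0 : ℝ) : ℂ) * (E₁ y * star (E₂ y) - E₂ y * star (E₁ y))) y) := by
    intro y
    rw [aux_mul 0 _ _ dX (((d₁.fun_mul e₁).fun_add (d₂.fun_mul e₂)).fun_add (d₃.fun_mul e₃)),
      aux_add 0 _ _ ((d₁.fun_mul e₁).fun_add (d₂.fun_mul e₂)) (d₃.fun_mul e₃),
      aux_add 0 _ _ (d₁.fun_mul e₁) (d₂.fun_mul e₂),
      aux_mul 0 _ _ d₁ e₁, aux_mul 0 _ _ d₂ e₂, aux_mul 0 _ _ d₃ e₃,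
      aux_mul 1 _ _ dX ((d₂.fun_mul e₃).fun_sub (d₃.fun_mul e₂)), aux_sub 1 _ _ (d₂.fun_mul e₃) (d₃.fun_mul e₂),
      aux_mul 1 _ _ d₂ e₃, aux_mul 1 _ _ d₃ e₂,
      aux_mul 2 _ _ dX ((d₃.fun_mul e₁).fun_sub (d₁.fun_mul e₃)), aux_sub 2 _ _ (d₃.fun_mul e₁) (d₁.fun_mul e₃),
      aux_mul 2 _ _ d₃ e₁, aux_mul 2 _ _ d₁ e₃,
      aux_mul 3 _ _ dX ((d₁.fun_mul e₂).fun_sub (d₂.fun_mul e₁)), aux_sub 3 _ _ (d₁.fun_mul e₂) (d₂.fun_mul e₁),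
      aux_mul 3 _ _ d₁ e₂, aux_mul 3 _ _ d₂ e₁]
    simp only [aux_conj, aux_X, m₁, m₂, m₃]
    simp
    ring
  have hint : ∫ y, (E₁ y * star (E₁ y) + E₂ y * star (E₂ y) + E₃ y * star (E₃ y)) = 0 := by
    rw [integral_congr_ae (Filter.Eventually.of_forall key)]
    rw [integral_sub J0.1 (((J1.1.fun_add J2.1).fun_add J3.1).const_mul _), integral_const_mul,
      integral_add (J1.1.fun_add J2.1) J3.1, integral_add J1.1 J2.1, J0.2, J1.2, J2.2, J3.2]
    simp
  have hreal : ∫ y, (‖E₁ y‖ ^ 2 + ‖E₂ y‖ ^ 2 + ‖E₃ y‖ ^ 2) = 0 := by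
    have : (((∫ y, (‖E₁ y‖ ^ 2 + ‖E₂ y‖ ^ 2 + ‖E₃ y‖ ^ 2) : ℝ)) : ℂ) = 0 := by
      rw [← integral_complex_ofReal, ← hint]
      congr 1
      ext y
      simp [Complex.mul_conj']
    exact_mod_cast this
  have hc : Continuous fun y => (‖E₁ y‖ ^ 2 + ‖E₂ y‖ ^ 2 + ‖E₃ y‖ ^ 2) := by
    have := h₁.continuous
    have := h₂.continuous
    have := h₃.continuous
    fun_prop
  have hcs : HasCompactSupport fun y => (‖E₁ y‖ ^ 2 + ‖E₂ y‖ ^ 2 + ‖E₃ y‖ ^ 2) :=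
    ((c₁.comp_left (g := fun z => ‖z‖ ^ 2) (by simp)).add
      (c₂.comp_left (g := fun z => ‖z‖ ^ 2) (by simp))).add
      (c₃.comp_left (g := fun z => ‖z‖ ^ 2) (by simp))
  have hz : ‖E₁ x‖ ^ 2 + ‖E₂ x‖ ^ 2 + ‖E₃ x‖ ^ 2 = 0 := by
    by_contra hne
    exact absurd hreal (hc.integral_pos_of_hasCompactSupport_nonneg_nonzero hcs
      (fun y => by positivity) hne).ne'
  have z₁ : ‖E₁ x‖ ^ 2 = 0 := by nlinarith [sq_nonneg ‖E₁ x‖, sq_nonneg ‖E₂ x‖, sq_nonneg ‖E₃ x‖]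
  have z₂ : ‖E₂ x‖ ^ 2 = 0 := by nlinarith [sq_nonneg ‖E₁ x‖, sq_nonneg ‖E₂ x‖, sq_nonneg ‖E₃ x‖]
  have z₃ : ‖E₃ x‖ ^ 2 = 0 := by nlinarith [sq_nonneg ‖E₁ x‖, sq_nonneg ‖E₂ x‖, sq_nonneg ‖E₃ x‖]
  exact ⟨by simpa using z₁, by simpa using z₂, by simpa using z₃⟩

theorem aux_conn (R : ℝ) (hR : 0 < R) :
    IsPreconnected (Metric.closedBall (0 : Fin 4 → ℝ) R)ᶜ := by
  have hrank : 1 < Module.rank ℝ (Fin 4 → ℝ) := by simp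
  have hS := isPreconnected_sphere hrank (0 : Fin 4 → ℝ) 1
  have hP := (isPreconnected_Ioi (a := R)).prod hS
  have := hP.image (fun p : ℝ × (Fin 4 → ℝ) => p.1 • p.2) (by fun_prop)
  convert this
  ext x
  simp only [Set.mem_compl_iff, mem_closedBall_zero_iff, not_le, Set.mem_image, Set.mem_prod,
    Set.mem_Ioi, mem_sphere_zero_iff_norm, Prod.exists]
  constructor
  · intro hx
    have hx0 : ‖x‖ ≠ 0 := by linarith
    refine ⟨‖x‖, ‖x‖⁻¹ • x, ⟨hx, ?_⟩, ?_⟩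
    · rw [norm_smul]; simp [hx0]
    · rw [smul_smul, mul_inv_cancel₀ hx0, one_smul]
  · rintro ⟨r, v, ⟨hr, hv⟩, rfl⟩
    rw [norm_smul, hv, mul_one, Real.norm_eq_abs]
    exact lt_of_lt_of_le hr (le_abs_self r)

theorem aux_exact (α : (Fin 4 → ℝ) → Fin 4 → ℂ)
    (hα : ContDiff ℝ (⊤ : ℕ∞) α) (hsupp : HasCompactSupport α)
    (hcl : ∀ x μ ν, pd4 μ (fun y => α y ν) x = pd4 ν (fun y => α y μ) x) :
    ∃ f : (Fin 4 → ℝ) → ℂ, ContDiff ℝ (⊤ : ℕ∞) f ∧ HasCompactSupport f ∧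
      ∀ x μ, α x μ = pd4 μ f x := by
  let L : Fin 4 → ℂ →L[ℝ] ((Fin 4 → ℝ) →L[ℝ] ℂ) := fun μ =>
    ContinuousLinearMap.smulRightL ℝ (Fin 4 → ℝ) ℂ (ContinuousLinearMap.proj μ)
  let w : (Fin 4 → ℝ) → ((Fin 4 → ℝ) →L[ℝ] ℂ) := fun x => ∑ μ, L μ (α x μ)
  have hwv : ∀ x v, w x v = ∑ μ, (v μ : ℂ) * α x μ := by
    intro x v
    simp [w, L]
  have hαμ : ∀ μ, ContDiff ℝ (⊤ : ℕ∞) (fun y => α y μ) := fun μ => contDiff_pi.1 hα μ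
  have hw : ContDiff ℝ (⊤ : ℕ∞) w :=
    ContDiff.sum fun μ _ => (L μ).contDiff.comp (hαμ μ)
  have hdw : ∀ a x y, fderiv ℝ w a x y = ∑ ν, ∑ μ, (x ν : ℂ) * (y μ : ℂ) *
      pd4 ν (fun y => α y μ) a := by
    intro a x y
    have h1 : HasFDerivAt w (∑ μ, (L μ).comp (fderiv ℝ (fun y => α y μ) a)) a := by
      apply HasFDerivAt.fun_sum
      intro μ _
      exact (L μ).hasFDerivAt.comp a
        ((hαμ μ).differentiable (by simp) a).hasFDerivAt
    have hx : ∀ μ, fderiv ℝ (fun y => α y μ) a x = ∑ ν, (x ν : ℂ) * pd4 ν (fun y => α y μ) a := by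
      intro μ
      conv_lhs => rw [pi_eq_sum_univ' x]
      simp [map_sum, pd4, Pi.single_apply]
    rw [h1.fderiv]
    simp only [sum_apply, ContinuousLinearMap.comp_apply, hx]
    rw [Finset.sum_comm]
    refine Finset.sum_congr rfl fun μ _ => ?_
    change (L μ (∑ ν, (x ν : ℂ) * pd4 ν (fun y => α y μ) a)) y = _
    simp only [L, ContinuousLinearMap.smulRightL_apply_apply, ContinuousLinearMap.smulRight_apply,
      ContinuousLinearMap.proj_apply, Complex.real_smul, Finset.mul_sum]
    refine Finset.sum_congr rfl fun ν _ => ?_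
    ring
  obtain ⟨f, hf⟩ := convex_univ.exists_forall_hasFDerivAt_of_fderiv_symmetric (ω := w) isOpen_univ
    (hw.differentiable (by simp)).differentiableOn (by
      intro a _ x y
      rw [hdw, hdw, Finset.sum_comm]
      refine Finset.sum_congr rfl fun μ _ => Finset.sum_congr rfl fun ν _ => ?_
      rw [hcl a ν μ]
      ring)
  have hf' : fderiv ℝ f = w := by
    ext1 x
    exact (hf x trivial).fderiv
  have hfd : Differentiable ℝ f := fun x => (hf x trivial).differentiableAt
  have hfs : ContDiff ℝ (⊤ : ℕ∞) f := by
    apply contDiff_infty_iff_fderiv.2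
    exact ⟨hfd, hf' ▸ hw⟩
  obtain ⟨R, hR0, hR⟩ : ∃ R : ℝ, 0 < R ∧ tsupport α ⊆ Metric.closedBall 0 R := by
    obtain ⟨R, hR⟩ := hsupp.isBounded.subset_closedBall 0
    exact ⟨max R 1, by positivity, hR.trans (Metric.closedBall_subset_closedBall (le_max_left _ _))⟩
  have hzero : ∀ x ∈ (Metric.closedBall (0 : Fin 4 → ℝ) R)ᶜ, fderiv ℝ f x = 0 := by
    intro x hx
    have : α x = 0 := image_eq_zero_of_notMem_tsupport fun h => hx (hR h)
    rw [hf']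
    simp [w, this]
  obtain ⟨c, hc⟩ := (Metric.isClosed_closedBall.isOpen_compl).exists_is_const_of_fderiv_eq_zero
    (aux_conn R hR0) hfd.differentiableOn hzero
  refine ⟨fun x => f x - c, hfs.sub contDiff_const, ?_, ?_⟩
  · apply HasCompactSupport.intro (isCompact_closedBall (0 : Fin 4 → ℝ) R)
    intro x hx
    simp [hc x hx]
  · intro x μ
    unfold pd4
    rw [fderiv_sub_const, hf', hwv]
    rw [Finset.sum_eq_single μ]
    · simp
    · intro b _ hb; simp [hb]
    · simp

/-- If `α` is a smooth compactly supported complex 1-form on ℝ⁴ whose exterior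
derivative is anti-self-dual (`★(dα) = −i·dα`, i.e. the self-dual part of `dα`
vanishes), then `α = df` for some smooth compactly supported `f : ℝ⁴ → ℂ`. -/
theorem compactly_supported_asd_one_form_exact
    (α : (Fin 4 → ℝ) → Fin 4 → ℂ)
    (hα : ContDiff ℝ (⊤ : ℕ∞) α) (hsupp : HasCompactSupport α)
    (hasd : ∀ x μ ν, hodge2 (extDerivOne α x) μ ν = - Complex.I * extDerivOne α x μ ν) :
    ∃ f : (Fin 4 → ℝ) → ℂ, ContDiff ℝ (⊤ : ℕ∞) f ∧ HasCompactSupport f ∧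
      ∀ x μ, α x μ = pd4 μ f x := by
  have hs : ∀ μ, ContDiff ℝ (⊤ : ℕ∞) (fun y => α y μ) := fun μ => contDiff_pi.1 hα μ
  have hc : ∀ μ, HasCompactSupport (fun y => α y μ) := fun μ =>
    hsupp.comp_left (g := fun v : Fin 4 → ℂ => v μ) rfl
  have hFs : ∀ μ ν, ContDiff ℝ (⊤ : ℕ∞) (fun x => extDerivOne α x μ ν) := fun μ ν =>
    (aux_smooth μ _ (hs ν)).sub (aux_smooth ν _ (hs μ))
  have hFc : ∀ μ ν, HasCompactSupport (fun x => extDerivOne α x μ ν) := fun μ ν =>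
    HasCompactSupport.sub ((hc ν).fderiv_apply (𝕜 := ℝ) _) ((hc μ).fderiv_apply (𝕜 := ℝ) _)
  have hanti : ∀ x μ ν, extDerivOne α x μ ν = - extDerivOne α x ν μ := by
    intro x μ ν
    simp [extDerivOne]
  have i2 : Int.sign 2 = 1 := rfl
  have i3 : Int.sign 3 = 1 := rfl
  have r1 : ∀ x, extDerivOne α x 2 3 = - Complex.I * extDerivOne α x 0 1 := by
    intro x
    rw [← hasd x 0 1]
    simp [hodge2, Fin.sum_univ_four, levi, mink]
    rw [hanti x 3 2, i2, i3]
    push_cast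
    ring
  have r2 : ∀ x, extDerivOne α x 3 1 = - Complex.I * extDerivOne α x 0 2 := by
    intro x
    rw [← hasd x 0 2]
    simp [hodge2, Fin.sum_univ_four, levi, mink]
    rw [hanti x 1 3, i2, i3]
    push_cast
    ring
  have r3 : ∀ x, extDerivOne α x 1 2 = - Complex.I * extDerivOne α x 0 3 := by
    intro x
    rw [← hasd x 0 3]
    simp [hodge2, Fin.sum_univ_four, levi, mink]
    rw [hanti x 2 1, i2, i3]
    push_cast
    ring
  have hdF : ∀ x l μ ν, pd4 l (fun x => extDerivOne α x μ ν) x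
      = pd4 l (pd4 μ (fun y => α y ν)) x - pd4 l (pd4 ν (fun y => α y μ)) x := by
    intro x l μ ν
    exact aux_sub l _ _ ((aux_smooth μ _ (hs ν)).differentiable (by simp))
      ((aux_smooth ν _ (hs μ)).differentiable (by simp)) x
  have bianchi : ∀ x μ ν, pd4 0 (fun x => extDerivOne α x μ ν) x
      = pd4 μ (fun x => extDerivOne α x 0 ν) x - pd4 ν (fun x => extDerivOne α x 0 μ) x := by
    intro x μ ν
    simp only [hdF]
    rw [aux_comm 0 μ _ (hs ν), aux_comm 0 ν _ (hs μ), aux_comm μ ν _ (hs 0)]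
    ring
  have conv : ∀ (μ ν k : Fin 4), (∀ x, extDerivOne α x μ ν = - Complex.I * extDerivOne α x 0 k) →
      ∀ x, pd4 0 (fun x => extDerivOne α x 0 k) x = Complex.I *
        (pd4 μ (fun x => extDerivOne α x 0 ν) x - pd4 ν (fun x => extDerivOne α x 0 μ) x) := by
    intro μ ν k h x
    rw [← bianchi x μ ν]
    have : (fun x => extDerivOne α x 0 k) = fun x => Complex.I * extDerivOne α x μ ν := by
      ext y
      rw [h y, ← mul_assoc]
      simp
    rw [this, aux_mul 0 _ _ (differentiable_const _) ((hFs μ ν).differentiable (by simp))]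
    simp [pd4]
  have hle : (1 : WithTop ℕ∞) ≤ ((⊤ : ℕ∞) : WithTop ℕ∞) := by exact_mod_cast le_top
  have hE := aux_energy (fun x => extDerivOne α x 0 1) (fun x => extDerivOne α x 0 2)
    (fun x => extDerivOne α x 0 3) ((hFs 0 1).of_le hle) ((hFs 0 2).of_le hle)
    ((hFs 0 3).of_le hle) (hFc 0 1) (hFc 0 2) (hFc 0 3)
    (conv 2 3 1 r1) (conv 3 1 2 r2) (conv 1 2 3 r3)
  apply aux_exact α hα hsupp
  intro x μ ν
  rw [← sub_eq_zero]
  change extDerivOne α x μ ν = 0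
  obtain ⟨f1, f2, f3⟩ := hE x
  have g1 := r1 x
  have g2 := r2 x
  have g3 := r3 x
  rw [f1, mul_zero] at g1
  rw [f2, mul_zero] at g2
  rw [f3, mul_zero] at g3
  have diag : ∀ k, extDerivOne α x k k = 0 := fun k => by simp [extDerivOne]
  fin_cases μ <;> fin_cases ν <;> simp only [Fin.mk_zero, Fin.mk_one, Fin.reduceFinMk, Fin.zero_eta,
    diag, f1, f2, f3, g1, g2, g3]
  all_goals
    rw [hanti]
    simp [f1, f2, f3, g1, g2, g3]
end

section
/- Let f be a smooth complex-valued 2-form on ℝ⁴ with df = 0 and ★f = −i·f (f is a closed anti-self-dual 2-form), and let β be a smooth compactly supported complex-valued 1-form on ℝ⁴. Then ∫_{ℝ⁴} ⟨f, ½(dβ + i·★(dβ))⟩ dx = 0, where ½(dβ + i★dβ) is the anti-self-dual part of dβ. (This is the well-definedness of the Serre-duality pairing (f,[g]) ↦ ∫_{ℝ⁴} ⟨f,g⟩ between Ker(d : Λ²₋ → Λ³) ≅ H¹_Q(Z,O(−4)) and Λ²_{−,c} / Im(d : Λ¹_c → Λ²_{−,c}) ≅ H¹_{Q,c}(Z,O(0))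 obtained from the Penrose transform over Minkowski space.) -/
open scoped BigOperators
open MeasureTheory

/-- The complex-bilinear pairing on 2-forms induced by the Minkowski metric:
`⟨dx^μ∧dx^ν, dx^ρ∧dx^σ⟩ = η^{μρ}η^{νσ} − η^{μσ}η^{νρ}`, in components
`⟨A, B⟩ = ½ ∑ η^{μμ} η^{νν} A_{μν} B_{μν}`. -/
noncomputable def minkPairing (A B : Fin 4 → Fin 4 → ℂ) : ℂ :=
  (1 / 2 : ℂ) * ∑ μ : Fin 4, ∑ ν : Fin 4, mink μ * mink ν * A μ ν * B μ ν

theorem sgn2 : Int.sign 2 = 1 := rfl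
theorem sgn3 : Int.sign 3 = 1 := rfl

theorem alg_key (A P : Fin 4 → Fin 4 → ℂ) (hA : ∀ μ ν, A μ ν = - A ν μ)
    (hs : ∀ μ ν, hodge2 A μ ν = - Complex.I * A μ ν) :
    minkPairing A (fun μ ν => (1 / 2 : ℂ) * ((P μ ν - P ν μ) + Complex.I *
      hodge2 (fun μ ν => P μ ν - P ν μ) μ ν)) =
    ∑ μ, ∑ ν, ∑ ρ, ∑ σ, (-Complex.I / 2 * (levi μ ν ρ σ : ℂ)) * (A ρ σ * P μ ν) := by
  have h0 := fun μ => self_eq_neg.mp (hA μ μ)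
  have h10 := hA 1 0
  have h20 := hA 2 0
  have h30 := hA 3 0
  have h21 := hA 2 1
  have h31 := hA 3 1
  have h32 := hA 3 2
  have s1 := hs 0 1
  have s2 := hs 0 2
  have s3 := hs 0 3
  simp [hodge2, levi, sgn2, sgn3, mink, Fin.sum_univ_four, h0, h10, h20, h30, h21, h31, h32] at s1 s2 s3
  have e1 : A 2 3 = -(Complex.I * A 0 1) := by linear_combination s1
  have e2 : A 1 3 = (Complex.I * A 0 2) := by linear_combination -s2
  have e3 : A 1 2 = -(Complex.I * A 0 3) := by linear_combination s3
  simp [minkPairing, hodge2, levi, sgn2, sgn3, mink, Fin.sum_univ_four, h0, h10, h20, h30, h21, h31, h32, e1, e2, e3]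
  ring_nf
  simp only [Complex.I_sq]
  ring

theorem alg_closed (D : Fin 4 → Fin 4 → Fin 4 → ℂ) (b : Fin 4 → ℂ)
    (hA : ∀ κ μ ν, D κ μ ν = - D κ ν μ)
    (hc : ∀ μ ν ρ, D μ ν ρ + D ν ρ μ + D ρ μ ν = 0) :
    ∑ μ, ∑ ν, ∑ ρ, ∑ σ, (-Complex.I / 2 * (levi μ ν ρ σ : ℂ)) * (D μ ρ σ * b ν) = 0 := by
  have h10 := fun κ => hA κ 1 0
  have h20 := fun κ => hA κ 2 0
  have h30 := fun κ => hA κ 3 0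
  have h21 := fun κ => hA κ 2 1
  have h31 := fun κ => hA κ 3 1
  have h32 := fun κ => hA κ 3 2
  have c0 := hc 1 2 3
  have c1 := hc 0 2 3
  have c2 := hc 0 1 3
  have c3 := hc 0 1 2
  simp only [h10, h20, h30, h21, h31, h32] at c0 c1 c2 c3
  simp [levi, sgn2, sgn3, Fin.sum_univ_four, h10, h20, h30, h21, h31, h32]
  linear_combination Complex.I * (b 0 * c0 - b 1 * c1 + b 2 * c2 - b 3 * c3)

theorem int_parts (g b : (Fin 4 → ℝ) → ℂ) (hg : ContDiff ℝ (⊤ : ℕ∞) g)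
    (hb : ContDiff ℝ (⊤ : ℕ∞) b) (hs : HasCompactSupport b) (μ : Fin 4) :
    Integrable (fun x => g x * pd4 μ b x) ∧ Integrable (fun x => pd4 μ g x * b x) ∧
    ∫ x, g x * pd4 μ b x = - ∫ x, pd4 μ g x * b x := by
  have cg : Continuous (fun x => fderiv ℝ g x (Pi.single μ 1)) :=
    (hg.continuous_fderiv (by simp)).clm_apply continuous_const
  have cb : Continuous (fun x => fderiv ℝ b x (Pi.single μ 1)) :=
    (hb.continuous_fderiv (by simp)).clm_apply continuous_const
  have sb : HasCompactSupport (fun x => fderiv ℝ b x (Pi.single μ 1)) :=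
    hs.fderiv_apply ℝ _
  have i1 : Integrable (fun x => g x * fderiv ℝ b x (Pi.single μ 1)) :=
    (hg.continuous.mul cb).integrable_of_hasCompactSupport sb.mul_left
  have i2 : Integrable (fun x => fderiv ℝ g x (Pi.single μ 1) * b x) :=
    (cg.mul hb.continuous).integrable_of_hasCompactSupport hs.mul_left
  have i3 : Integrable (fun x => g x * b x) :=
    (hg.continuous.mul hb.continuous).integrable_of_hasCompactSupport hs.mul_left
  exact ⟨i1, i2, integral_mul_fderiv_eq_neg_fderiv_mul_of_integrable i2 i1 i3
    (fun x _ => (hg.differentiable (by simp)) x) (fun x _ => (hb.differentiable (by simp)) x)⟩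

/-- Let `f` be a smooth closed anti-self-dual complex 2-form on ℝ⁴ (components
`f x μ ν`, antisymmetric, with `df = 0` and `★f = −i·f`) and let `β` be a smooth
compactly supported complex 1-form. Then `∫_{ℝ⁴} ⟨f, ½(dβ + i·★(dβ))⟩ = 0`, where
`½(dβ + i★dβ)` is the anti-self-dual part of `dβ`. -/
theorem serre_pairing_well_defined_asd_two_forms
    (f : (Fin 4 → ℝ) → Fin 4 → Fin 4 → ℂ)
    (hf : ContDiff ℝ (⊤ : ℕ∞) f)
    (hf_alt : ∀ x μ ν, f x μ ν = - f x ν μ)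
    (hf_closed : ∀ x μ ν ρ,
      pd4 μ (fun y => f y ν ρ) x + pd4 ν (fun y => f y ρ μ) x
        + pd4 ρ (fun y => f y μ ν) x = 0)
    (hf_asd : ∀ x μ ν, hodge2 (f x) μ ν = - Complex.I * f x μ ν)
    (β : (Fin 4 → ℝ) → Fin 4 → ℂ)
    (hβ : ContDiff ℝ (⊤ : ℕ∞) β) (hβsupp : HasCompactSupport β) :
    ∫ x : Fin 4 → ℝ, minkPairing (f x)
      (fun μ ν => (1 / 2 : ℂ) *
        (extDerivOne β x μ ν + Complex.I * hodge2 (extDerivOne β x) μ ν)) = 0 := by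
  have hfc : ∀ ρ σ, ContDiff ℝ (⊤ : ℕ∞) (fun y => f y ρ σ) := fun ρ σ =>
    contDiff_pi.mp (contDiff_pi.mp hf ρ) σ
  have hβc : ∀ ν, ContDiff ℝ (⊤ : ℕ∞) (fun y => β y ν) := fun ν => contDiff_pi.mp hβ ν
  have hβs : ∀ ν, HasCompactSupport (fun y => β y ν) := fun ν =>
    hβsupp.comp_left (g := fun v : Fin 4 → ℂ => v ν) rfl
  have key := fun μ ν ρ σ => int_parts _ _ (hfc ρ σ) (hβc ν) (hβs ν) μ
  have h1 : ∀ x, minkPairing (f x)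
      (fun μ ν => (1 / 2 : ℂ) *
        (extDerivOne β x μ ν + Complex.I * hodge2 (extDerivOne β x) μ ν)) =
      ∑ μ, ∑ ν, ∑ ρ, ∑ σ, (-Complex.I / 2 * (levi μ ν ρ σ : ℂ)) *
        (f x ρ σ * pd4 μ (fun y => β y ν) x) := fun x =>
    alg_key (f x) (fun μ ν => pd4 μ (fun y => β y ν) x) (hf_alt x) (hf_asd x)
  have h2 : ∀ x, ∑ μ, ∑ ν, ∑ ρ, ∑ σ, (-Complex.I / 2 * (levi μ ν ρ σ : ℂ)) *
        (pd4 μ (fun y => f y ρ σ) x * β x ν) = 0 := fun x =>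
    alg_closed (fun μ ρ σ => pd4 μ (fun y => f y ρ σ) x) (β x)
      (fun κ μ ν => by
        have : (fun y => f y μ ν) = fun y => -(f y ν μ) := funext fun y => hf_alt y μ ν
        simp only [pd4, this, fderiv_fun_neg]
        simp) (hf_closed x)
  have I1 := fun μ ν ρ σ => (key μ ν ρ σ).1.const_mul (-Complex.I / 2 * (levi μ ν ρ σ : ℂ))
  have I2 := fun μ ν ρ σ => (key μ ν ρ σ).2.1.const_mul (-Complex.I / 2 * (levi μ ν ρ σ : ℂ))
  have I3 : ∀ μ ν ρ σ, Integrable (fun x => -((-Complex.I / 2 * (levi μ ν ρ σ : ℂ)) *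
        (pd4 μ (fun y => f y ρ σ) x * β x ν))) := fun μ ν ρ σ => (I2 μ ν ρ σ).neg
  have h3 : ∫ x, ∑ μ, ∑ ν, ∑ ρ, ∑ σ, (-Complex.I / 2 * (levi μ ν ρ σ : ℂ)) *
        (f x ρ σ * pd4 μ (fun y => β y ν) x) =
      - ∫ x, ∑ μ, ∑ ν, ∑ ρ, ∑ σ, (-Complex.I / 2 * (levi μ ν ρ σ : ℂ)) *
        (pd4 μ (fun y => f y ρ σ) x * β x ν) := by
    rw [← integral_neg]
    simp only [← Finset.sum_neg_distrib]
    rw [integral_finsetSum _ fun μ _ => integrable_finsetSum _ fun ν _ =>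
      integrable_finsetSum _ fun ρ _ => integrable_finsetSum _ fun σ _ => I1 μ ν ρ σ,
      integral_finsetSum _ fun μ _ => integrable_finsetSum _ fun ν _ =>
      integrable_finsetSum _ fun ρ _ => integrable_finsetSum _ fun σ _ => I3 μ ν ρ σ]
    refine Finset.sum_congr rfl fun μ _ => ?_
    rw [integral_finsetSum _ fun ν _ =>
      integrable_finsetSum _ fun ρ _ => integrable_finsetSum _ fun σ _ => I1 μ ν ρ σ,
      integral_finsetSum _ fun ν _ =>
      integrable_finsetSum _ fun ρ _ => integrable_finsetSum _ fun σ _ => I3 μ ν ρ σ]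
    refine Finset.sum_congr rfl fun ν _ => ?_
    rw [integral_finsetSum _ fun ρ _ => integrable_finsetSum _ fun σ _ => I1 μ ν ρ σ,
      integral_finsetSum _ fun ρ _ => integrable_finsetSum _ fun σ _ => I3 μ ν ρ σ]
    refine Finset.sum_congr rfl fun ρ _ => ?_
    rw [integral_finsetSum _ fun σ _ => I1 μ ν ρ σ,
      integral_finsetSum _ fun σ _ => I3 μ ν ρ σ]
    refine Finset.sum_congr rfl fun σ _ => ?_
    rw [integral_const_mul, (key μ ν ρ σ).2.2, integral_neg, integral_const_mul]
    ring
  simp only [h1]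
  rw [h3]
  simp only [h2]
  simp
end

section
/- Let α, γ : ℝ⁴ → ℂ² be smooth. Then one has the pointwise divergence identity ε(α, D⁺γ) − ε(γ, D⁻α) = ∂₀(ε(α,γ)) + ∂₁(ε(α, σ¹γ)) + ∂₂(ε(α, σ²γ)) + ∂₃(ε(α, σ³γ)), where ε(u,v) = u₁v₂ − u₂v₁. -/
open scoped BigOperators Matrix

/-- The first Pauli matrix `σ¹ = [[0,1],[1,0]]`. -/
noncomputable def pauli1 : Matrix (Fin 2) (Fin 2) ℂ := !![0, 1; 1, 0]

/-- The second Pauli matrix `σ² = [[0,−i],[i,0]]`. -/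
noncomputable def pauli2 : Matrix (Fin 2) (Fin 2) ℂ := !![0, -Complex.I; Complex.I, 0]

/-- The third Pauli matrix `σ³ = [[1,0],[0,−1]]`. -/
noncomputable def pauli3 : Matrix (Fin 2) (Fin 2) ℂ := !![1, 0; 0, -1]

/-- The partial derivative in the `μ`-th coordinate direction of a `ℂ²`-valued
function on ℝ⁴. -/
noncomputable def pdV (μ : Fin 4) (ψ : (Fin 4 → ℝ) → Fin 2 → ℂ) (x : Fin 4 → ℝ) :
    Fin 2 → ℂ :=
  fderiv ℝ ψ x (Pi.single μ 1)

/-- The Weyl (Dirac) operator `D⁺ψ = ∂₀ψ + σ¹∂₁ψ + σ²∂₂ψ + σ³∂₃ψ`. -/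
noncomputable def weylPlus (ψ : (Fin 4 → ℝ) → Fin 2 → ℂ) (x : Fin 4 → ℝ) : Fin 2 → ℂ :=
  pdV 0 ψ x + pauli1.mulVec (pdV 1 ψ x) + pauli2.mulVec (pdV 2 ψ x)
    + pauli3.mulVec (pdV 3 ψ x)

/-- The Weyl (Dirac) operator `D⁻ψ = ∂₀ψ − σ¹∂₁ψ − σ²∂₂ψ − σ³∂₃ψ`. -/
noncomputable def weylMinus (ψ : (Fin 4 → ℝ) → Fin 2 → ℂ) (x : Fin 4 → ℝ) : Fin 2 → ℂ :=
  pdV 0 ψ x - pauli1.mulVec (pdV 1 ψ x) - pauli2.mulVec (pdV 2 ψ x)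
    - pauli3.mulVec (pdV 3 ψ x)

/-- The complex bilinear skew form `ε(u,v) = u₁v₂ − u₂v₁` on ℂ². -/
def epsForm (u v : Fin 2 → ℂ) : ℂ := u 0 * v 1 - u 1 * v 0

/-- Leibniz rule for `epsForm` composed with a matrix. -/
theorem pd4_epsForm_mulVec (μ : Fin 4) (M : Matrix (Fin 2) (Fin 2) ℂ)
    (α γ : (Fin 4 → ℝ) → Fin 2 → ℂ) (x : Fin 4 → ℝ)
    (hα : DifferentiableAt ℝ α x) (hγ : DifferentiableAt ℝ γ x) :
    pd4 μ (fun y => epsForm (α y) (M.mulVec (γ y))) x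
      = epsForm (pdV μ α x) (M.mulVec (γ x)) + epsForm (α x) (M.mulVec (pdV μ γ x)) := by
  have ha := fun i => hasFDerivAt_pi'.1 hα.hasFDerivAt i
  have hg := fun i => hasFDerivAt_pi'.1 hγ.hasFDerivAt i
  have h := ((ha 0).mul (((hg 0).const_mul (M 1 0)).add ((hg 1).const_mul (M 1 1)))).sub
    ((ha 1).mul (((hg 0).const_mul (M 0 0)).add ((hg 1).const_mul (M 0 1))))
  have e : (fun y => epsForm (α y) (M.mulVec (γ y))) = fun y =>
      α y 0 * (M 1 0 * γ y 0 + M 1 1 * γ y 1) - α y 1 * (M 0 0 * γ y 0 + M 0 1 * γ y 1) := by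
    funext y
    simp [epsForm, Matrix.mulVec, dotProduct, Fin.sum_univ_two]
  unfold pd4
  rw [e]
  refine (congrArg (fun L => L (Pi.single μ 1)) h.fderiv).trans ?_
  simp [epsForm, pdV, Matrix.mulVec, dotProduct, Fin.sum_univ_two]
  ring

/-- For smooth `α, γ : ℝ⁴ → ℂ²` one has the pointwise divergence identity
`ε(α, D⁺γ) − ε(γ, D⁻α) = ∂₀(ε(α,γ)) + ∂₁(ε(α,σ¹γ)) + ∂₂(ε(α,σ²γ)) + ∂₃(ε(α,σ³γ))`. -/
theorem dirac_divergence_identity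
    (α γ : (Fin 4 → ℝ) → Fin 2 → ℂ)
    (hα : ContDiff ℝ (⊤ : ℕ∞) α) (hγ : ContDiff ℝ (⊤ : ℕ∞) γ) :
    ∀ x, epsForm (α x) (weylPlus γ x) - epsForm (γ x) (weylMinus α x)
      = pd4 0 (fun y => epsForm (α y) (γ y)) x
        + pd4 1 (fun y => epsForm (α y) (pauli1.mulVec (γ y))) x
        + pd4 2 (fun y => epsForm (α y) (pauli2.mulVec (γ y))) x
        + pd4 3 (fun y => epsForm (α y) (pauli3.mulVec (γ y))) x := by
  intro x
  have ha := (hα.differentiable (by simp)) x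
  have hg := (hγ.differentiable (by simp)) x
  have h0 := pd4_epsForm_mulVec 0 1 α γ x ha hg
  simp only [Matrix.one_mulVec] at h0
  rw [h0, pd4_epsForm_mulVec 1 pauli1 α γ x ha hg, pd4_epsForm_mulVec 2 pauli2 α γ x ha hg,
    pd4_epsForm_mulVec 3 pauli3 α γ x ha hg]
  simp [epsForm, weylPlus, weylMinus, pauli1, pauli2, pauli3, Matrix.mulVec, dotProduct,
    Fin.sum_univ_two, Matrix.vecHead, Matrix.vecTail]
  ring
end

section
/- Let α : ℝ⁴ → ℂ² be smooth with D⁻α = 0, and let γ : ℝ⁴ → ℂ² be smooth with compact support. Then ∫_{ℝ⁴} ε(α, D⁺γ) dx = 0. (This is the well-definedness of the Serre-duality pairing (α,[β]) ↦ ∫_{ℝ⁴} ε(α,β) between Ker D⁻ ≅ H¹_Q(Z,O(−3)) and Coker D⁺_c ≅ H¹_{Q,c}(Z,O(−1)) obtained from the Penrose transform over Minkowski space.) -/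
open scoped BigOperators Matrix
open MeasureTheory

/-- Total derivative `∂_μ (α_i γ_j)`. -/
noncomputable def totD (α γ : (Fin 4 → ℝ) → Fin 2 → ℂ) (μ : Fin 4) (i j : Fin 2)
    (x : Fin 4 → ℝ) : ℂ :=
  pdV μ α x i * γ x j + α x i * pdV μ γ x j

theorem totD_props (α γ : (Fin 4 → ℝ) → Fin 2 → ℂ)
    (hα : ContDiff ℝ (⊤ : ℕ∞) α)
    (hγ : ContDiff ℝ (⊤ : ℕ∞) γ) (hγsupp : HasCompactSupport γ) (μ : Fin 4) (i j : Fin 2) :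
    Integrable (totD α γ μ i j) ∧ ∫ x, totD α γ μ i j x = 0 := by
  have hne : ((⊤ : ℕ∞) : WithTop ℕ∞) ≠ 0 := by simp
  have ca : Continuous α := hα.continuous
  have cg : Continuous γ := hγ.continuous
  have cda : Continuous (fun x => pdV μ α x) :=
    (hα.continuous_fderiv hne).clm_apply continuous_const
  have cdg : Continuous (fun x => pdV μ γ x) :=
    (hγ.continuous_fderiv hne).clm_apply continuous_const
  have sg : HasCompactSupport (fun x => γ x j) :=
    hγsupp.comp_left (g := fun v : Fin 2 → ℂ => v j) rfl
  have sdg : HasCompactSupport (fun x => pdV μ γ x j) :=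
    (hγsupp.fderiv (𝕜 := ℝ)).comp_left
      (g := fun L : (Fin 4 → ℝ) →L[ℝ] (Fin 2 → ℂ) => L (Pi.single μ 1) j) rfl
  have i1 : Integrable (fun x => pdV μ α x i * γ x j) :=
    Continuous.integrable_of_hasCompactSupport (by fun_prop) sg.mul_left
  have i2 : Integrable (fun x => α x i * pdV μ γ x j) :=
    Continuous.integrable_of_hasCompactSupport (by fun_prop) sdg.mul_left
  have i3 : Integrable (fun x => α x i * γ x j) :=
    Continuous.integrable_of_hasCompactSupport (by fun_prop) sg.mul_left
  refine ⟨i1.add i2, ?_⟩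
  have ha : ∀ x, HasFDerivAt (fun x => α x i)
      ((ContinuousLinearMap.proj i).comp (fderiv ℝ α x)) x := fun x =>
    hasFDerivAt_pi'.1 ((hα.differentiable hne) x).hasFDerivAt i
  have hg : ∀ x, HasFDerivAt (fun x => γ x j)
      ((ContinuousLinearMap.proj j).comp (fderiv ℝ γ x)) x := fun x =>
    hasFDerivAt_pi'.1 ((hγ.differentiable hne) x).hasFDerivAt j
  have key := integral_bilinear_hasLineDerivAt_right_eq_neg_left_of_integrable
    (μ := (volume : Measure (Fin 4 → ℝ)))
    (f := fun x => α x i) (f' := fun x => pdV μ α x i) (g := fun x => γ x j)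
    (g' := fun x => pdV μ γ x j) (v := Pi.single μ 1) (B := ContinuousLinearMap.mul ℝ ℂ)
    i1 i2 i3 (fun x _ => (ha x).hasLineDerivAt _) (fun x _ => (hg x).hasLineDerivAt _)
  simp only [ContinuousLinearMap.mul_apply'] at key
  unfold totD
  rw [integral_add i1 i2, key, add_neg_cancel]

theorem zint_add {f g : (Fin 4 → ℝ) → ℂ} (hf : Integrable f ∧ ∫ x, f x = 0)
    (hg : Integrable g ∧ ∫ x, g x = 0) :
    Integrable (fun x => f x + g x) ∧ ∫ x, (f x + g x) = 0 :=
  ⟨hf.1.add hg.1, by rw [integral_add hf.1 hg.1, hf.2, hg.2, add_zero]⟩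

theorem zint_smul {f : (Fin 4 → ℝ) → ℂ} (a : ℂ) (hf : Integrable f ∧ ∫ x, f x = 0) :
    Integrable (fun x => a * f x) ∧ ∫ x, a * f x = 0 :=
  ⟨hf.1.const_mul a, by rw [integral_const_mul, hf.2, mul_zero]⟩

/-- If `α : ℝ⁴ → ℂ²` is smooth with `D⁻α = 0` and `γ : ℝ⁴ → ℂ²` is smooth with
compact support, then `∫_{ℝ⁴} ε(α, D⁺γ) = 0`. -/
theorem serre_pairing_well_defined_dirac
    (α γ : (Fin 4 → ℝ) → Fin 2 → ℂ)
    (hα : ContDiff ℝ (⊤ : ℕ∞) α) (hαker : ∀ x, weylMinus α x = 0)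
    (hγ : ContDiff ℝ (⊤ : ℕ∞) γ) (hγsupp : HasCompactSupport γ) :
    ∫ x : Fin 4 → ℝ, epsForm (α x) (weylPlus γ x) = 0 := by
  have hpt : ∀ x, epsForm (α x) (weylPlus γ x) =
      totD α γ 0 0 1 x + totD α γ 1 0 0 x + Complex.I * totD α γ 2 0 0 x
      + (-1) * totD α γ 3 0 1 x + (-1) * totD α γ 0 1 0 x + (-1) * totD α γ 1 1 1 x
      + Complex.I * totD α γ 2 1 1 x + (-1) * totD α γ 3 1 0 x := by
    intro x
    have h0 := congrFun (hαker x) 0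
    have h1 := congrFun (hαker x) 1
    simp [weylMinus, pauli1, pauli2, pauli3, Matrix.mulVec, dotProduct,
      Fin.sum_univ_two, Matrix.vecHead, Matrix.vecTail] at h0 h1
    simp [epsForm, weylPlus, pauli1, pauli2, pauli3, Matrix.mulVec, dotProduct,
      Fin.sum_univ_two, totD, Matrix.vecHead, Matrix.vecTail]
    linear_combination (-γ x 1) * h0 + γ x 0 * h1
  simp_rw [hpt]
  have p := totD_props α γ hα hγ hγsupp
  have c := fun (a : ℂ) μ i j => zint_smul a (p μ i j)
  exact (zint_add (zint_add (zint_add (zint_add (zint_add (zint_add (zint_add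
    (p 0 0 1) (p 1 0 0)) (c Complex.I 2 0 0)) (c (-1) 3 0 1)) (c (-1) 0 1 0))
    (c (-1) 1 1 1)) (c Complex.I 2 1 1)) (c (-1) 3 1 0)).2
end

section
/- If ψ : ℝ⁴ → ℂ² is a smooth function with compact support satisfying D⁺ψ = 0, then ψ is identically zero. (Injectivity on compactly supported sections of the Weyl–Dirac operator appearing at the E₁ level of the compactly supported Penrose transform for O(−1).) -/
open scoped BigOperators Matrix

open MeasureTheory in
lemma ibp_aux (J : (Fin 4 → ℝ) → ℝ) (hJ : ContDiff ℝ 1 J) (hc : HasCompactSupport J) (μ : Fin 4) :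
    Integrable (fun x => fderiv ℝ J x (Pi.single μ 1) * x 0) ∧
    ∫ x, J x * (Pi.single μ 1 : Fin 4 → ℝ) 0 = - ∫ x, fderiv ℝ J x (Pi.single μ 1) * x 0 := by
  have hg : ∀ x : Fin 4 → ℝ, fderiv ℝ (fun y : Fin 4 → ℝ => y 0) x
      = ContinuousLinearMap.proj 0 := fun x =>
    (ContinuousLinearMap.proj (R := ℝ) (φ := fun _ : Fin 4 => ℝ) 0).hasFDerivAt.fderiv
  have hcd : Continuous fun x => fderiv ℝ J x (Pi.single μ 1) :=
    (hJ.continuous_fderiv (by norm_num)).clm_apply continuous_const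
  have hcs : HasCompactSupport fun x => fderiv ℝ J x (Pi.single μ 1) :=
    hc.fderiv_apply (𝕜 := ℝ) _
  have i1 : Integrable (fun x => fderiv ℝ J x (Pi.single μ 1) * x 0) :=
    (hcd.mul (continuous_apply 0)).integrable_of_hasCompactSupport hcs.mul_right
  refine ⟨i1, ?_⟩
  have := integral_mul_fderiv_eq_neg_fderiv_mul_of_integrable (μ := (volume : Measure (Fin 4 → ℝ)))
    (f := J) (g := fun y : Fin 4 → ℝ => y 0) (v := Pi.single μ 1) i1
    (by
      simp only [hg]
      exact (hJ.continuous.mul continuous_const).integrable_of_hasCompactSupport hc.mul_right)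
    ((hJ.continuous.mul (continuous_apply 0)).integrable_of_hasCompactSupport hc.mul_right)
    (fun x _ => hJ.differentiable (by norm_num) x) (fun x _ => by fun_prop)
  simpa only [hg, ContinuousLinearMap.proj_apply] using this

open MeasureTheory in
/-- If `ψ : ℝ⁴ → ℂ²` is smooth with compact support and `D⁺ψ = 0`, then `ψ ≡ 0`. -/
theorem compactly_supported_weyl_kernel_vanishes
    (ψ : (Fin 4 → ℝ) → Fin 2 → ℂ)
    (hψ : ContDiff ℝ (⊤ : ℕ∞) ψ) (hsupp : HasCompactSupport ψ)
    (heq : ∀ x, weylPlus ψ x = 0) :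
    ∀ x, ψ x = 0 := by
  have hψ1 : ContDiff ℝ 1 ψ := hψ.of_le (by exact_mod_cast le_top)
  let R (i : Fin 2) : (Fin 2 → ℂ) →L[ℝ] ℝ :=
    Complex.reCLM.comp (ContinuousLinearMap.proj (R := ℝ) (φ := fun _ : Fin 2 => ℂ) i)
  let M (i : Fin 2) : (Fin 2 → ℂ) →L[ℝ] ℝ :=
    Complex.imCLM.comp (ContinuousLinearMap.proj (R := ℝ) (φ := fun _ : Fin 2 => ℂ) i)
  have key : ∀ L : (Fin 2 → ℂ) →L[ℝ] ℝ, ContDiff ℝ 1 (fun x => L (ψ x)) ∧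
      HasCompactSupport (fun x => L (ψ x)) ∧
      ∀ x, HasFDerivAt (fun x => L (ψ x)) (L.comp (fderiv ℝ ψ x)) x := fun L =>
    ⟨L.contDiff.comp hψ1, hsupp.comp_left (g := L) (map_zero L), fun x =>
      L.hasFDerivAt.comp x (hψ1.differentiable (by norm_num) x).hasFDerivAt⟩
  obtain ⟨cp, sp, dp⟩ := key (R 0)
  obtain ⟨cq, sq, dq⟩ := key (M 0)
  obtain ⟨cr, sr, dr⟩ := key (R 1)
  obtain ⟨cs, ss, ds⟩ := key (M 1)
  set p := fun x => R 0 (ψ x) with hp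
  set q := fun x => M 0 (ψ x) with hq
  set r := fun x => R 1 (ψ x) with hr
  set s := fun x => M 1 (ψ x) with hs
  let J0 : (Fin 4 → ℝ) → ℝ := p * p + q * q + (r * r + s * s)
  let J1 : (Fin 4 → ℝ) → ℝ := p * r + q * s + (p * r + q * s)
  let J2 : (Fin 4 → ℝ) → ℝ := p * s - q * r + (p * s - q * r)
  let J3 : (Fin 4 → ℝ) → ℝ := p * p + q * q - (r * r + s * s)
  have S : ∀ {f g : (Fin 4 → ℝ) → ℝ}, HasCompactSupport f → HasCompactSupport g →
      HasCompactSupport (f - g) := fun hf hg => by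
    rw [sub_eq_add_neg]; exact hf.add hg.neg
  have c0 : ContDiff ℝ 1 J0 := ((cp.mul cp).add (cq.mul cq)).add ((cr.mul cr).add (cs.mul cs))
  have c1 : ContDiff ℝ 1 J1 := ((cp.mul cr).add (cq.mul cs)).add ((cp.mul cr).add (cq.mul cs))
  have c2 : ContDiff ℝ 1 J2 := ((cp.mul cs).sub (cq.mul cr)).add ((cp.mul cs).sub (cq.mul cr))
  have c3 : ContDiff ℝ 1 J3 := ((cp.mul cp).add (cq.mul cq)).sub ((cr.mul cr).add (cs.mul cs))
  have s0 : HasCompactSupport J0 :=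
    (sp.mul_right.add sq.mul_right).add (sr.mul_right.add ss.mul_right)
  have s1 : HasCompactSupport J1 :=
    (sp.mul_right.add sq.mul_right).add (sp.mul_right.add sq.mul_right)
  have s2 : HasCompactSupport J2 :=
    (S sp.mul_right sq.mul_right).add (S sp.mul_right sq.mul_right)
  have s3 : HasCompactSupport J3 :=
    S (sp.mul_right.add sq.mul_right) (sr.mul_right.add ss.mul_right)
  obtain ⟨i0, e0⟩ := ibp_aux J0 c0 s0 0
  obtain ⟨i1, e1⟩ := ibp_aux J1 c1 s1 1
  obtain ⟨i2, e2⟩ := ibp_aux J2 c2 s2 2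
  obtain ⟨i3, e3⟩ := ibp_aux J3 c3 s3 3
  have hdiv : ∀ x, fderiv ℝ J0 x (Pi.single 0 1) + fderiv ℝ J1 x (Pi.single 1 1)
      + fderiv ℝ J2 x (Pi.single 2 1) + fderiv ℝ J3 x (Pi.single 3 1) = 0 := by
    intro x
    have d0 := ((((dp x).mul (dp x)).add ((dq x).mul (dq x))).add
      (((dr x).mul (dr x)).add ((ds x).mul (ds x)))).fderiv
    have d1 := ((((dp x).mul (dr x)).add ((dq x).mul (ds x))).add
      (((dp x).mul (dr x)).add ((dq x).mul (ds x)))).fderiv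
    have d2 := ((((dp x).mul (ds x)).sub ((dq x).mul (dr x))).add
      (((dp x).mul (ds x)).sub ((dq x).mul (dr x)))).fderiv
    have d3 := ((((dp x).mul (dp x)).add ((dq x).mul (dq x))).sub
      (((dr x).mul (dr x)).add ((ds x).mul (ds x)))).fderiv
    have h := heq x
    have h0 := congrFun h 0
    have h1 := congrFun h 1
    simp only [weylPlus, pdV, pauli1, pauli2, pauli3, Matrix.mulVec, dotProduct,
      Fin.sum_univ_two, Pi.add_apply, Pi.zero_apply] at h0 h1
    have h0r := congrArg Complex.re h0
    have h0i := congrArg Complex.im h0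
    have h1r := congrArg Complex.re h1
    have h1i := congrArg Complex.im h1
    simp at h0r h0i h1r h1i
    change fderiv ℝ J0 x = _ at d0
    change fderiv ℝ J1 x = _ at d1
    change fderiv ℝ J2 x = _ at d2
    change fderiv ℝ J3 x = _ at d3
    rw [d0, d1, d2, d3]
    simp [R, M, p, q, r, s]
    linear_combination 2 * (ψ x 0).re * h0r + 2 * (ψ x 0).im * h0i
      + 2 * (ψ x 1).re * h1r + 2 * (ψ x 1).im * h1i
  have hint : ∫ x, J0 x = 0 := by
    have z : ∫ x : Fin 4 → ℝ, (fderiv ℝ J0 x (Pi.single 0 1) * x 0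
      + fderiv ℝ J1 x (Pi.single 1 1) * x 0
      + fderiv ℝ J2 x (Pi.single 2 1) * x 0 + fderiv ℝ J3 x (Pi.single 3 1) * x 0) = 0 := by
      simp only [← add_mul, hdiv, zero_mul, integral_zero]
    have z1 := integral_add ((i0.add i1).add i2) i3
    have z2 := integral_add (i0.add i1) i2
    have z3 := integral_add i0 i1
    simp only [Pi.add_apply] at z1 z2 z3
    rw [z1, z2, z3] at z
    simp at e0 e1 e2 e3
    linarith
  have hnn : 0 ≤ J0 := fun x => by
    simp only [J0, Pi.add_apply, Pi.mul_apply, Pi.zero_apply]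
    nlinarith [mul_self_nonneg (p x), mul_self_nonneg (q x), mul_self_nonneg (r x),
      mul_self_nonneg (s x)]
  have hz : J0 = 0 := by
    have := (integral_eq_zero_iff_of_nonneg hnn
      (c0.continuous.integrable_of_hasCompactSupport s0)).1 hint
    exact (c0.continuous.ae_eq_iff_eq volume continuous_const).1 this
  intro x
  have hx := congrFun hz x
  simp only [J0, Pi.add_apply, Pi.mul_apply, Pi.zero_apply] at hx
  have a1 := mul_self_nonneg (p x)
  have a2 := mul_self_nonneg (q x)
  have a3 := mul_self_nonneg (r x)
  have a4 := mul_self_nonneg (s x)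
  have b1 : p x = 0 := mul_self_eq_zero.1 (by linarith)
  have b2 : q x = 0 := mul_self_eq_zero.1 (by linarith)
  have b3 : r x = 0 := mul_self_eq_zero.1 (by linarith)
  have b4 : s x = 0 := mul_self_eq_zero.1 (by linarith)
  ext i
  fin_cases i
  · exact Complex.ext b1 b2
  · exact Complex.ext b3 b4
end
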